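/- arXiv:math/9808018 — 4 statements merged into one kernel-verified Lean document; each statement's English description precedes it below -/
import Mathlib

section
/- Let x, y and n be nonnegative integers with x + y > 0. Then det(K_n(x,y)) = ∏_{i=0}^{n-1} [ i! · (x+y+i-1)! · (2x+y+2i)_i · (x+2y+2i)_i ] / [ (x+2i)! · (y+2i)! ]. -/
open Finset

/-- The shifted factorial (ascending Pochhammer): `(a)_k = a(a+1)⋯(a+k-1)`, as a rational. -/
def asc (a k : ℕ) : ℚ := ∏ m ∈ Finset.range k, ((a : ℚ) + m)

/-- The matrix `K_n(x,y)` of Krattenthaler: `(i,j)` entry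
`(x+y+i+j-1)! / ((x+2i-j)! (y+2j-i)!)` if `x+2i-j ≥ 0` and `y+2j-i ≥ 0`, else `0`. -/
def Kmat (n x y : ℕ) : Matrix (Fin n) (Fin n) ℚ := fun i j =>
  if (j : ℕ) ≤ x + 2 * (i : ℕ) ∧ (i : ℕ) ≤ y + 2 * (j : ℕ) then
    ((x + y + (i : ℕ) + (j : ℕ) - 1).factorial : ℚ) /
      (((x + 2 * (i : ℕ) - (j : ℕ)).factorial : ℚ) *
        ((y + 2 * (j : ℕ) - (i : ℕ)).factorial : ℚ))
  else 0

namespace KrattenthalerDet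

open Matrix

/-- The equivalence listing the elements of `Fin (n + 1)` as `0` and the successors. -/
noncomputable def firstEquiv (n : ℕ) : Unit ⊕ Fin n ≃ Fin (n + 1) :=
  Equiv.ofBijective (Sum.elim (fun _ => 0) Fin.succ) <| by
    rw [Fintype.bijective_iff_injective_and_card]
    refine ⟨?_, by simp [add_comm]⟩
    rintro (a | a) (b | b) h <;> simp_all [Fin.ext_iff]

/-- The equivalence listing the elements of `Fin (n + 1)` as `Fin.last n` and the others. -/
noncomputable def lastEquiv (n : ℕ) : Unit ⊕ Fin n ≃ Fin (n + 1) :=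
  Equiv.ofBijective (Sum.elim (fun _ => Fin.last n) Fin.castSucc) <| by
    rw [Fintype.bijective_iff_injective_and_card]
    refine ⟨?_, by simp [add_comm]⟩
    rintro (a | a) (b | b) h <;> simp_all [Fin.ext_iff] <;> omega

/-- The equivalence listing the elements of `Fin (n + 2)` as the two ends and the interior. -/
noncomputable def endsEquiv (n : ℕ) : Fin 2 ⊕ Fin n ≃ Fin (n + 2) :=
  Equiv.ofBijective (Sum.elim ![0, Fin.last (n + 1)] fun i : Fin n => i.succ.castSucc) <| by
    rw [Fintype.bijective_iff_injective_and_card]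
    refine ⟨?_, by simp [add_comm]⟩
    rintro (a | a) (b | b) h
    · fin_cases a <;> fin_cases b <;> simp_all [Fin.ext_iff]
    · fin_cases a <;> simp_all [Fin.ext_iff]
      omega
    · fin_cases b <;> simp_all [Fin.ext_iff]
      omega
    · simp_all [Fin.ext_iff]

/-- Bordering an invertible block by one row and one column: the determinant is the one of the
block times the corresponding entry of the Schur complement. -/
theorem det_bordered {R m n : Type*} [CommRing R] [Fintype n] [DecidableEq n]
    (A : Matrix m m R) (B : Matrix m n R) (C : Matrix n m R) (D : Matrix n n R) [Invertible D]
    (p q : m) :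
    (fromBlocks (of fun _ _ : Unit => A p q) (of fun _ : Unit => B p)
      (of fun i (_ : Unit) => C i q) D).det = D.det * (A - B * ⅟D * C) p q := by
  rw [det_fromBlocks₂₂, det_unique (n := Unit)]
  simp [Matrix.mul_apply]

/-- The Desnanot-Jacobi identity (Dodgson condensation), for an invertible interior minor. -/
theorem det_mul_det_interior {K : Type*} [Field K] {n : ℕ}
    (A : Matrix (Fin (n + 2)) (Fin (n + 2)) K)
    (hA : (A.submatrix (fun i : Fin n => i.succ.castSucc) fun i : Fin n => i.succ.castSucc).det ≠ 0) :
    A.det * (A.submatrix (fun i : Fin n => i.succ.castSucc) fun i : Fin n => i.succ.castSucc).det =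
      (A.submatrix Fin.castSucc Fin.castSucc).det * (A.submatrix Fin.succ Fin.succ).det -
        (A.submatrix Fin.succ Fin.castSucc).det * (A.submatrix Fin.castSucc Fin.succ).det := by
  set D := A.submatrix (fun i : Fin n => i.succ.castSucc) fun i : Fin n => i.succ.castSucc
  let e : Fin 2 → Fin (n + 2) := ![0, Fin.last (n + 1)]
  let P := A.submatrix e e
  let B := A.submatrix e fun i : Fin n => i.succ.castSucc
  let C := A.submatrix (fun i : Fin n => i.succ.castSucc) e
  let _ : Invertible D := invertibleOfIsUnitDet D hA.isUnit
  have hfull : A.det = D.det * (P - B * ⅟D * C).det := by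
    rw [← det_fromBlocks₂₂, ← det_submatrix_equiv_self (endsEquiv n) A]
    congr 1
    ext (i | i) (j | j) <;> rfl
  have h00 : (A.submatrix Fin.castSucc Fin.castSucc).det = D.det * (P - B * ⅟D * C) 0 0 := by
    rw [← det_bordered, ← det_submatrix_equiv_self (firstEquiv n)]
    congr 1
    ext (i | i) (j | j) <;> rfl
  have h11 : (A.submatrix Fin.succ Fin.succ).det = D.det * (P - B * ⅟D * C) 1 1 := by
    rw [← det_bordered, ← det_submatrix_equiv_self (lastEquiv n)]
    congr 1
    ext (i | i) (j | j) <;> rfl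
  let σ : Equiv.Perm (Fin (n + 1)) := (lastEquiv n).symm.trans (firstEquiv n)
  have hσ (i) : σ (lastEquiv n i) = firstEquiv n i := by simp [σ]
  have h10 : (Equiv.Perm.sign σ : K) * (A.submatrix Fin.succ Fin.castSucc).det =
      D.det * (P - B * ⅟D * C) 1 0 := by
    rw [← det_bordered, ← det_permute', ← det_submatrix_equiv_self (lastEquiv n)]
    congr 1
    ext (i | i) (j | j) <;> simp only [submatrix_apply, hσ] <;> rfl
  have h01 : (Equiv.Perm.sign σ : K) * (A.submatrix Fin.castSucc Fin.succ).det =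
      D.det * (P - B * ⅟D * C) 0 1 := by
    rw [← det_bordered, ← det_permute, ← det_submatrix_equiv_self (lastEquiv n)]
    congr 1
    ext (i | i) (j | j) <;> simp only [submatrix_apply, hσ] <;> rfl
  have hsign : (Equiv.Perm.sign σ : K) * (Equiv.Perm.sign σ : K) = 1 := by
    rcases Int.units_eq_one_or (Equiv.Perm.sign σ) with h | h <;> simp [h]
  rw [det_fin_two] at hfull
  rw [hfull, h00, h11]
  linear_combination
    -(A.submatrix Fin.succ Fin.castSucc).det * (A.submatrix Fin.castSucc Fin.succ).det * hsign +
      (Equiv.Perm.sign σ : K) * (A.submatrix Fin.castSucc Fin.succ).det * h10 +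
      D.det * (P - B * ⅟D * C) 1 0 * h01

theorem asc_succ (a k : ℕ) : asc a (k + 1) = a * asc (a + 1) k := by
  rw [asc, Finset.prod_range_succ', mul_comm, Nat.cast_zero, add_zero, asc]
  congr 1
  refine Finset.prod_congr rfl fun m _ => ?_
  push_cast
  ring

theorem asc_pos {a : ℕ} (ha : 0 < a) (k : ℕ) : 0 < asc a k :=
  Finset.prod_pos fun _ _ => by positivity

/-- The `i`-th factor of the product evaluating `det (Kmat n x y)`. -/
def factor (x y i : ℕ) : ℚ :=
  ((i.factorial : ℚ) * ((x + y + i - 1).factorial : ℚ) *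
      asc (2 * x + y + 2 * i) i * asc (x + 2 * y + 2 * i) i) /
    (((x + 2 * i).factorial : ℚ) * ((y + 2 * i).factorial : ℚ))

theorem factor_pos {x y : ℕ} (h : 0 < x + y) (i : ℕ) : 0 < factor x y i := by
  have h₁ := asc_pos (a := 2 * x + y + 2 * i) (by omega) i
  have h₂ := asc_pos (a := x + 2 * y + 2 * i) (by omega) i
  unfold factor
  positivity

theorem factor_succ {x y : ℕ} (h : 0 < x + y) (m : ℕ) :
    factor x y (m + 1) * ((x + y + m + 1) * (x + 2 * m + 2) * (y + 2 * m + 2)) =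
      factor (x + 1) (y + 1) m * ((m + 1) * (2 * x + y + 2 * m + 2) * (x + 2 * y + 2 * m + 2)) := by
  unfold factor
  rw [asc_succ, asc_succ,
    show 2 * (x + 1) + (y + 1) + 2 * m = 2 * x + y + 2 * (m + 1) + 1 by ring,
    show x + 1 + 2 * (y + 1) + 2 * m = x + 2 * y + 2 * (m + 1) + 1 by ring,
    show x + 1 + (y + 1) + m - 1 = (x + y + m) + 1 by omega,
    show x + y + (m + 1) - 1 = x + y + m by omega,
    show x + 2 * (m + 1) = (x + 1 + 2 * m) + 1 by ring,
    show y + 2 * (m + 1) = (y + 1 + 2 * m) + 1 by ring]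
  simp only [Nat.factorial_succ]
  push_cast
  field_simp
  ring

theorem factor_mul_factor (x y m : ℕ) :
    factor (x + 3) y m * factor x (y + 3) m *
        ((x + y + m + 3) * (x + 2 * m + 3) * (y + 2 * m + 3)) =
      factor (x + 1) (y + 1) m * factor (x + 2) (y + 2) m *
        ((x + y + m + 2) * (x + 2 * m + 1) * (y + 2 * m + 1)) := by
  unfold factor
  rw [show 2 * (x + 3) + y + 2 * m = 2 * (x + 2) + (y + 2) + 2 * m by ring,
    show x + 3 + 2 * y + 2 * m = x + 1 + 2 * (y + 1) + 2 * m by ring,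
    show 2 * x + (y + 3) + 2 * m = 2 * (x + 1) + (y + 1) + 2 * m by ring,
    show x + 2 * (y + 3) + 2 * m = x + 2 + 2 * (y + 2) + 2 * m by ring,
    show x + 3 + y + m - 1 = (x + y + m + 1) + 1 by omega,
    show x + (y + 3) + m - 1 = (x + y + m + 1) + 1 by omega,
    show x + 1 + (y + 1) + m - 1 = x + y + m + 1 by omega,
    show x + 2 + (y + 2) + m - 1 = (x + y + m + 1) + 1 + 1 by omega,
    show x + 3 + 2 * m = x + 2 * m + 1 + 1 + 1 by ring,
    show x + 2 + 2 * m = x + 2 * m + 1 + 1 by ring,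
    show x + 1 + 2 * m = x + 2 * m + 1 by ring,
    show y + 3 + 2 * m = y + 2 * m + 1 + 1 + 1 by ring,
    show y + 2 + 2 * m = y + 2 * m + 1 + 1 by ring,
    show y + 1 + 2 * m = y + 2 * m + 1 by ring]
  simp only [Nat.factorial_succ]
  push_cast
  field_simp
  ring

/-- The product evaluating `det (Kmat n x y)`. -/
def value (n x y : ℕ) : ℚ := ∏ i ∈ Finset.range n, factor x y i

theorem value_succ (n x y : ℕ) : value (n + 1) x y = value n x y * factor x y n :=
  Finset.prod_range_succ _ _

theorem value_pos (n : ℕ) {x y : ℕ} (h : 0 < x + y) : 0 < value n x y :=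
  Finset.prod_pos fun i _ => factor_pos h i

theorem value_mul_value (m x y : ℕ) :
    value m (x + 3) y * value m x (y + 3) *
        ((x + y + m + 2) * (x + 2 * m + 1) * (y + 2 * m + 1)) =
      value m (x + 1) (y + 1) * value m (x + 2) (y + 2) *
        ((x + 1) * (y + 1) * (x + y + 2)) := by
  induction m with
  | zero => simp [value]; ring
  | succ m ih =>
    have hf := factor_mul_factor x y m
    have hc : ((x + y + m + 2) * (x + 2 * m + 1) * (y + 2 * m + 1) : ℚ) ≠ 0 := by positivity
    simp only [value_succ]
    push_cast
    refine mul_right_cancel₀ hc ?_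
    linear_combination
      factor (x + 3) y m * factor x (y + 3) m *
        ((x + y + m + 3) * (x + 2 * m + 3) * (y + 2 * m + 3)) * ih +
      value m (x + 1) (y + 1) * value m (x + 2) (y + 2) *
        ((x + 1) * (y + 1) * (x + y + 2)) * hf

/-- The condensation recurrence for `value`, away from the boundary. -/
theorem value_condensation (n x y : ℕ) :
    value (n + 2) (x + 1) (y + 1) * value n (x + 2) (y + 2) =
      value (n + 1) (x + 1) (y + 1) * value (n + 1) (x + 2) (y + 2) -
        value (n + 1) (x + 3) y * value (n + 1) x (y + 3) := by
  have h₁ := factor_succ (x := x + 1) (y := y + 1) (by omega) n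
  have h₂ := value_mul_value (n + 1) x y
  have hc : ((x + y + n + 3) * (x + 2 * n + 3) * (y + 2 * n + 3) : ℚ) ≠ 0 := by positivity
  rw [value_succ (n + 1) (x + 1), value_succ n (x + 2)] at *
  refine mul_right_cancel₀ hc ?_
  push_cast at h₁ h₂
  linear_combination
    value (n + 1) (x + 1) (y + 1) * value n (x + 2) (y + 2) * h₁ + h₂

/-- The condensation recurrence for `value`, on the boundary. -/
theorem value_condensation_boundary (n : ℕ) {x y : ℕ} (h : 0 < x + y) (hxy : x * y = 0) :
    value (n + 2) x y * value n (x + 1) (y + 1) =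
      value (n + 1) x y * value (n + 1) (x + 1) (y + 1) := by
  have h₁ := factor_succ h n
  have hxy' : (x * y : ℚ) = 0 := by exact_mod_cast hxy
  have hc : ((x + y + n + 1) * (x + 2 * n + 2) * (y + 2 * n + 2) : ℚ) ≠ 0 := by positivity
  rw [value_succ (n + 1) x, value_succ n (x + 1)]
  refine mul_right_cancel₀ hc ?_
  linear_combination
    value (n + 1) x y * value n (x + 1) (y + 1) * h₁ -
      value (n + 1) x y * value n (x + 1) (y + 1) * factor (x + 1) (y + 1) n * (x + y) * hxy'

/-- Entries of `Kmat` agree as soon as the parameters of two of the three factorials do. -/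
theorem Kmat_apply_eq {n n' x y x' y' : ℕ} {i j : Fin n} {i' j' : Fin n'}
    (hs : x + y + i + j = x' + y' + i' + j') (hx : x + 2 * (i : ℕ) + j' = x' + 2 * (i' : ℕ) + j) :
    Kmat n x y i j = Kmat n' x' y' i' j' := by
  unfold Kmat
  rw [hs, show x + 2 * (i : ℕ) - j = x' + 2 * (i' : ℕ) - j' by omega,
    show y + 2 * (j : ℕ) - i = y' + 2 * (j' : ℕ) - i' by omega]
  exact if_congr (by omega) rfl rfl

theorem Kmat_submatrix_interior (n x y : ℕ) :
    (Kmat (n + 2) x y).submatrix (fun i : Fin n => i.succ.castSucc) (fun i : Fin n => i.succ.castSucc) =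
      Kmat n (x + 1) (y + 1) := by
  ext i j
  apply Kmat_apply_eq <;> simp <;> omega

theorem Kmat_submatrix_castSucc (n x y : ℕ) :
    (Kmat (n + 1) x y).submatrix Fin.castSucc Fin.castSucc = Kmat n x y := by
  ext i j
  apply Kmat_apply_eq <;> simp

theorem Kmat_submatrix_succ (n x y : ℕ) :
    (Kmat (n + 1) x y).submatrix Fin.succ Fin.succ = Kmat n (x + 1) (y + 1) := by
  ext i j
  apply Kmat_apply_eq <;> simp <;> omega

theorem Kmat_submatrix_succ_castSucc (n x y : ℕ) :
    (Kmat (n + 1) x (y + 1)).submatrix Fin.succ Fin.castSucc = Kmat n (x + 2) y := by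
  ext i j
  apply Kmat_apply_eq <;> simp <;> omega

theorem Kmat_submatrix_castSucc_succ (n x y : ℕ) :
    (Kmat (n + 1) (x + 1) y).submatrix Fin.castSucc Fin.succ = Kmat n x (y + 2) := by
  ext i j
  apply Kmat_apply_eq <;> simp <;> omega

theorem det_Kmat_submatrix_succ_castSucc_zero (n x : ℕ) :
    ((Kmat (n + 2) x 0).submatrix Fin.succ Fin.castSucc).det = 0 :=
  det_eq_zero_of_column_eq_zero 0 fun i => by simp [Kmat]

theorem det_Kmat_submatrix_castSucc_succ_zero (n y : ℕ) :
    ((Kmat (n + 2) 0 y).submatrix Fin.castSucc Fin.succ).det = 0 :=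
  det_eq_zero_of_row_eq_zero 0 fun i => by simp [Kmat]

theorem det_Kmat_eq_value (n : ℕ) : ∀ x y : ℕ, 0 < x + y → (Kmat n x y).det = value n x y := by
  induction n using Nat.twoStepInduction with
  | zero => simp [value]
  | one => intro x y _; simp [value, factor, Kmat, asc]
  | more n ih₀ ih₁ =>
    intro x y h
    have hpos := (value_pos n (x := x + 1) (y := y + 1) (by omega)).ne'
    have hD := det_mul_det_interior (Kmat (n + 2) x y) (by
      rwa [Kmat_submatrix_interior, ih₀ _ _ (by omega)])
    rw [Kmat_submatrix_interior, Kmat_submatrix_castSucc, Kmat_submatrix_succ,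
      ih₀ _ _ (by omega), ih₁ _ _ h, ih₁ _ _ (by omega)] at hD
    refine mul_right_cancel₀ hpos (hD.trans ?_)
    rcases x with _ | x
    · rw [det_Kmat_submatrix_castSucc_succ_zero, mul_zero, sub_zero,
        value_condensation_boundary n h (by simp)]
    rcases y with _ | y
    · rw [det_Kmat_submatrix_succ_castSucc_zero, zero_mul, sub_zero,
        value_condensation_boundary n h (by simp)]
    rw [Kmat_submatrix_succ_castSucc, Kmat_submatrix_castSucc_succ, ih₁ _ _ (by omega),
      ih₁ _ _ (by omega), value_condensation]

end KrattenthalerDet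

theorem det_Kmat (n x y : ℕ) (h : 0 < x + y) :
    (Kmat n x y).det =
      ∏ i ∈ Finset.range n,
        ((i.factorial : ℚ) * ((x + y + i - 1).factorial : ℚ) *
            asc (2 * x + y + 2 * i) i * asc (x + 2 * y + 2 * i) i) /
          (((x + 2 * i).factorial : ℚ) * ((y + 2 * i).factorial : ℚ)) := by
  exact KrattenthalerDet.det_Kmat_eq_value n x y h
end

section
/- Let x, y be positive integers and n ≥ 2 an integer. Then det(K_n(x,y)) · det(K_{n-2}(x+1,y+1)) = det(K_{n-1}(x+1,y+1)) · det(K_{n-1}(x,y)) − det(K_{n-1}(x+2,y-1)) · det(K_{n-1}(x-1,y+2)). -/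
open Finset

namespace Matrix

variable {R l m : Type*} [CommRing R] [Fintype l] [DecidableEq l] [Fintype m] [DecidableEq m]

theorem det_toBlocks₁₁_adjugate_mul_det (A : Matrix (l ⊕ m) (l ⊕ m) R) :
    A.adjugate.toBlocks₁₁.det * A.det = A.det ^ Fintype.card l * A.toBlocks₂₂.det := by
  have hA := A.mul_adjugate
  rw [← fromBlocks_toBlocks A.adjugate, ← fromBlocks_one, fromBlocks_smul] at hA
  nth_rw 1 [← fromBlocks_toBlocks A] at hA
  rw [fromBlocks_multiply, fromBlocks_inj] at hA
  have key : A * fromBlocks A.adjugate.toBlocks₁₁ 0 A.adjugate.toBlocks₂₁ 1 =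
      fromBlocks (A.det • 1) A.toBlocks₁₂ 0 A.toBlocks₂₂ := by
    nth_rw 1 [← fromBlocks_toBlocks A]
    simp [fromBlocks_multiply, hA.1, hA.2.2.1]
  have hdet := congrArg det key
  rw [det_mul, det_fromBlocks_zero₁₂, det_fromBlocks_zero₂₁, det_smul, det_one, det_one, mul_one,
    mul_one] at hdet
  rw [mul_comm, hdet]

/-- **Jacobi's complementary minor formula** for a diagonal block of the adjugate. -/
theorem det_toBlocks₁₁_adjugate [Nonempty l] (A : Matrix (l ⊕ m) (l ⊕ m) R) :
    A.adjugate.toBlocks₁₁.det = A.det ^ (Fintype.card l - 1) * A.toBlocks₂₂.det := by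
  let X := mvPolynomialX (l ⊕ m) (l ⊕ m) ℤ
  have hX : X.adjugate.toBlocks₁₁.det = X.det ^ (Fintype.card l - 1) * X.toBlocks₂₂.det := by
    apply mul_right_cancel₀ (det_mvPolynomialX_ne_zero (l ⊕ m) ℤ)
    rw [det_toBlocks₁₁_adjugate_mul_det, mul_right_comm, ← pow_succ,
      Nat.sub_add_cancel Fintype.card_pos]
  let f := MvPolynomial.eval₂Hom (Int.castRingHom R) fun p : (l ⊕ m) × (l ⊕ m) => A p.1 p.2
  have hf : f.mapMatrix X = A := by
    ext i j
    simp [X, f]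
  have hmap := congrArg f hX
  rw [map_mul, map_pow, RingHom.map_det, RingHom.map_det, RingHom.map_det, hf] at hmap
  have h₁ : f.mapMatrix X.adjugate.toBlocks₁₁ = A.adjugate.toBlocks₁₁ := by
    rw [← hf, ← RingHom.map_adjugate]
    rfl
  have h₂ : f.mapMatrix X.toBlocks₂₂ = A.toBlocks₂₂ := by
    rw [← hf]
    rfl
  rwa [h₁, h₂] at hmap

/-- The **Desnanot–Jacobi identity**, the basis of Dodgson condensation. -/
theorem det_mul_det_submatrix_succ_castSucc {k : ℕ} (A : Matrix (Fin (k + 2)) (Fin (k + 2)) R) :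
    A.det * (A.submatrix (fun i : Fin k => i.castSucc.succ) fun j => j.castSucc.succ).det =
      (A.submatrix Fin.succ Fin.succ).det * (A.submatrix Fin.castSucc Fin.castSucc).det -
        (A.submatrix Fin.succ Fin.castSucc).det * (A.submatrix Fin.castSucc Fin.succ).det := by
  let g : Fin 2 ⊕ Fin k → Fin (k + 2) :=
    Sum.elim ![0, Fin.last (k + 1)] fun i => i.castSucc.succ
  have hg : Function.Bijective g := by
    refine (Fintype.bijective_iff_injective_and_card g).2 ⟨?_, by simp [add_comm]⟩
    rintro (i | i) (j | j) h
    · fin_cases i <;> fin_cases j <;> simp [g, Fin.ext_iff] at h ⊢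
    · fin_cases i <;> simp [g, Fin.ext_iff] at h
      omega
    · fin_cases j <;> simp [g, Fin.ext_iff] at h
      omega
    · simpa [g, Fin.ext_iff] using h
  let e := Equiv.ofBijective g hg
  have h := det_toBlocks₁₁_adjugate (A.submatrix e e)
  rw [adjugate_submatrix_equiv_self, det_submatrix_equiv_self, det_fin_two] at h
  have h₀ : e (Sum.inl 0) = 0 := rfl
  have h₁ : e (Sum.inl 1) = Fin.last (k + 1) := rfl
  have h₂ : (A.submatrix e e).toBlocks₂₂ =
      A.submatrix (fun i : Fin k => i.castSucc.succ) fun j => j.castSucc.succ := rfl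
  have hsign : ((-1 : R) ^ (k + 1)) * (-1) ^ (k + 1) = 1 := by
    rw [← mul_pow]
    simp
  simp only [toBlocks₁₁, of_apply, submatrix_apply, h₀, h₁, h₂, adjugate_fin_succ_eq_det_submatrix,
    Fin.val_zero, Fin.val_last, Fin.succAbove_zero, Fin.succAbove_last, Fintype.card_fin,
    Nat.add_one_sub_one, pow_one, add_zero, zero_add, pow_add _ (k + 1) (k + 1), hsign,
    pow_zero, one_mul] at h
  linear_combination -h - (A.submatrix Fin.succ Fin.castSucc).det *
    (A.submatrix Fin.castSucc Fin.succ).det * hsign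

end Matrix

theorem det_Kmat_recurrence (x y n : ℕ) (hx : 0 < x) (hy : 0 < y) (hn : 2 ≤ n) :
    (Kmat n x y).det * (Kmat (n - 2) (x + 1) (y + 1)).det =
      (Kmat (n - 1) (x + 1) (y + 1)).det * (Kmat (n - 1) x y).det -
        (Kmat (n - 1) (x + 2) (y - 1)).det * (Kmat (n - 1) (x - 1) (y + 2)).det := by
  obtain ⟨k, rfl⟩ := Nat.exists_eq_add_of_le' hn
  obtain ⟨x, rfl⟩ := Nat.exists_eq_succ_of_ne_zero hx.ne'
  obtain ⟨y, rfl⟩ := Nat.exists_eq_succ_of_ne_zero hy.ne'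
  have entry_congr {n₁ n₂ x₁ x₂ y₁ y₂ : ℕ} {i₁ j₁ : Fin n₁} {i₂ j₂ : Fin n₂}
      (ha : (x₁ + 2 * i₁ - j₁ : ℤ) = x₂ + 2 * i₂ - j₂)
      (hb : (y₁ + 2 * j₁ - i₁ : ℤ) = y₂ + 2 * j₂ - i₂) :
      Kmat n₁ x₁ y₁ i₁ j₁ = Kmat n₂ x₂ y₂ i₂ j₂ := by
    unfold Kmat
    congr 1
    · apply propext
      omega
    · congr 3
      · congr 1
        omega
      · congr 1
        omega
      · congr 1
        omega
  have inner : Kmat k (x + 2) (y + 2) = (Kmat (k + 2) (x + 1) (y + 1)).submatrix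
      (fun i : Fin k => i.castSucc.succ) fun j => j.castSucc.succ := by
    ext i j
    apply entry_congr <;> simp <;> omega
  have succ_succ : Kmat (k + 1) (x + 2) (y + 2) =
      (Kmat (k + 2) (x + 1) (y + 1)).submatrix Fin.succ Fin.succ := by
    ext i j
    apply entry_congr <;> simp <;> omega
  have succ_castSucc : Kmat (k + 1) (x + 3) y =
      (Kmat (k + 2) (x + 1) (y + 1)).submatrix Fin.succ Fin.castSucc := by
    ext i j
    apply entry_congr <;> simp <;> omega
  have castSucc_succ : Kmat (k + 1) x (y + 3) =
      (Kmat (k + 2) (x + 1) (y + 1)).submatrix Fin.castSucc Fin.succ := by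
    ext i j
    apply entry_congr <;> simp <;> omega
  change (Kmat (k + 2) (x + 1) (y + 1)).det * (Kmat k (x + 2) (y + 2)).det =
    (Kmat (k + 1) (x + 2) (y + 2)).det * (Kmat (k + 1) (x + 1) (y + 1)).det -
      (Kmat (k + 1) (x + 3) y).det * (Kmat (k + 1) x (y + 3)).det
  rw [inner, succ_succ, succ_castSucc, castSucc_succ]
  exact Matrix.det_mul_det_submatrix_succ_castSucc _
end

section
/- Let x be a positive integer and n a nonnegative integer. Then det( (1/2)·C(x+i+j-1, 2i-j) + C(x+i+j-1, 2i-j-1) )_{0≤i,j≤n-1} = 2^{-n} · ∏_{i=0}^{n-1} (x+3i) · ∏_{i=0}^{n-1} [ i! · (x+i-1)! · (2x+2i)_i · (x+2i)_i ] / [ (x+2i)! · (2i)! ]. -/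
open Finset

/-- Binomial coefficient `C(m,k)` for `m : ℕ` and `k : ℤ`, zero if `k < 0` or `k > m`. -/
def C (m : ℕ) (k : ℤ) : ℚ := if 0 ≤ k then (m.choose k.toNat : ℚ) else 0

namespace Matrix

section Condensation

variable {R : Type*} [CommRing R]

theorem det_mul_det_toBlocks₂₂_adjugate {m k : Type*} [Fintype m] [DecidableEq m] [Fintype k]
    [DecidableEq k] (A : Matrix (m ⊕ k) (m ⊕ k) R) :
    A.det * A.adjugate.toBlocks₂₂.det = A.toBlocks₁₁.det * A.det ^ Fintype.card k := by
  have key : A * fromBlocks 1 A.adjugate.toBlocks₁₂ 0 A.adjugate.toBlocks₂₂ =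
      fromBlocks A.toBlocks₁₁ 0 A.toBlocks₂₁ (A.det • 1) := by
    have h := A.mul_adjugate
    rw [← fromBlocks_toBlocks A, ← fromBlocks_toBlocks (adjugate _), fromBlocks_multiply,
      ← fromBlocks_one, fromBlocks_smul, fromBlocks_inj, fromBlocks_toBlocks] at h
    conv_lhs => rw [← fromBlocks_toBlocks A]
    rw [fromBlocks_multiply, fromBlocks_toBlocks, h.2.1, h.2.2.2]
    simp
  have h := congrArg det key
  rwa [det_mul, det_fromBlocks_zero₂₁, det_fromBlocks_zero₁₂, det_one, one_mul, det_smul, det_one,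
    mul_one] at h

/-- The indices of `Fin (n + 2)` split into the interior ones and the two extreme ones. -/
noncomputable def finInteriorEquiv (n : ℕ) : Fin n ⊕ Fin 2 ≃ Fin (n + 2) :=
  Equiv.ofBijective (Sum.elim (fun i => i.castSucc.succ) ![0, Fin.last (n + 1)]) <| by
    rw [Fintype.bijective_iff_injective_and_card]
    refine ⟨?_, by simp⟩
    rintro (a | a) (b | b) h
    · simpa using h
    · fin_cases b <;> simp [Fin.ext_iff] at h
      omega
    · fin_cases a <;> simp [Fin.ext_iff] at h
      omega
    · fin_cases a <;> fin_cases b <;> simp [Fin.ext_iff] at h ⊢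

/-- The Desnanot–Jacobi identity, multiplied by the determinant of the matrix. -/
theorem det_mul_desnanot_jacobi {n : ℕ} (A : Matrix (Fin (n + 2)) (Fin (n + 2)) R) :
    A.det * (A.det * (A.submatrix (fun i : Fin n => i.castSucc.succ)
        (fun j : Fin n => j.castSucc.succ)).det) =
      A.det * ((A.submatrix Fin.castSucc Fin.castSucc).det * (A.submatrix Fin.succ Fin.succ).det -
        (A.submatrix Fin.succ Fin.castSucc).det * (A.submatrix Fin.castSucc Fin.succ).det) := by
  have h := det_mul_det_toBlocks₂₂_adjugate
    (A.submatrix (finInteriorEquiv n) (finInteriorEquiv n))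
  rw [adjugate_submatrix_equiv_self, det_submatrix_equiv_self, Fintype.card_fin] at h
  have h₁ : (A.submatrix (finInteriorEquiv n) (finInteriorEquiv n)).toBlocks₁₁ =
      A.submatrix (fun i : Fin n => i.castSucc.succ) (fun j : Fin n => j.castSucc.succ) := rfl
  have h₂ : (A.adjugate.submatrix (finInteriorEquiv n) (finInteriorEquiv n)).toBlocks₂₂ =
      !![A.adjugate 0 0, A.adjugate 0 (Fin.last _);
        A.adjugate (Fin.last _) 0, A.adjugate (Fin.last _) (Fin.last _)] := by
    ext i j
    fin_cases i <;> fin_cases j <;> rfl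
  have hsign : ((-1 : R) ^ (n + 1)) * (-1) ^ (n + 1) = 1 := by
    rw [← mul_pow]; simp
  rw [h₁, h₂, det_fin_two_of] at h
  simp only [adjugate_fin_succ_eq_det_submatrix, Fin.succAbove_zero, Fin.succAbove_last,
    Fin.val_zero, Fin.val_last, add_zero, zero_add, pow_zero, one_mul, pow_add] at h
  linear_combination (-1 : R) * h + A.det * ((A.submatrix Fin.castSucc Fin.castSucc).det *
    (A.submatrix Fin.succ Fin.succ).det -
        (A.submatrix Fin.succ Fin.castSucc).det * (A.submatrix Fin.castSucc Fin.succ).det) * hsign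

/-- The Desnanot–Jacobi identity (Dodgson condensation). -/
theorem desnanot_jacobi {n : ℕ} (A : Matrix (Fin (n + 2)) (Fin (n + 2)) R) :
    A.det * (A.submatrix (fun i : Fin n => i.castSucc.succ) (fun j : Fin n => j.castSucc.succ)).det =
      (A.submatrix Fin.castSucc Fin.castSucc).det * (A.submatrix Fin.succ Fin.succ).det -
        (A.submatrix Fin.succ Fin.castSucc).det * (A.submatrix Fin.castSucc Fin.succ).det := by
  let X := mvPolynomialX (Fin (n + 2)) (Fin (n + 2)) ℤ
  let f : MvPolynomial (Fin (n + 2) × Fin (n + 2)) ℤ →+* R :=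
    (MvPolynomial.aeval fun p : Fin (n + 2) × Fin (n + 2) => A p.1 p.2 : _ →ₐ[ℤ] R)
  have hX : X.map f = A := by
    ext i j
    simp [X, f, mvPolynomialX]
  have h := congrArg f (mul_left_cancel₀ (det_mvPolynomialX_ne_zero (Fin (n + 2)) ℤ)
    (det_mul_desnanot_jacobi X))
  simpa only [map_mul, map_sub, RingHom.map_det, RingHom.mapMatrix_apply, ← submatrix_map, hX]
    using h

end Condensation

end Matrix

section Krattenthaler

variable {R : Type*} [CommRing R]

/-- Up to row and column factors, the matrix with entries
`(x + y + i + j - 1)! / ((x + 2 * i - j)! * (y + 2 * j - i)!)`. -/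
noncomputable def krattenthalerMatrix (n : ℕ) (x y : R) : Matrix (Fin n) (Fin n) R :=
  Matrix.of fun i j => (ascPochhammer R j).eval (x + y + (i : ℕ)) *
    (descPochhammer R j).eval (x + 2 * (i : ℕ)) * (descPochhammer R i).eval (y + 2 * (j : ℕ))

/-- The `i`-th factor of the determinant of `krattenthalerMatrix`. -/
noncomputable def krattenthalerFactor (i : ℕ) (x y : R) : R :=
  i.factorial * (ascPochhammer R i).eval (2 * x + y + 2 * i) *
    (ascPochhammer R i).eval (x + 2 * y + 2 * i)

theorem ascPochhammer_eval_succ_left (k : ℕ) (a : R) :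
    (ascPochhammer R (k + 1)).eval a = a * (ascPochhammer R k).eval (a + 1) := by
  simp [ascPochhammer_succ_left]

theorem descPochhammer_eval_succ_left (k : ℕ) (a : R) :
    (descPochhammer R (k + 1)).eval a = a * (descPochhammer R k).eval (a - 1) := by
  simp [descPochhammer_succ_left]

theorem Matrix.det_mul_row_mul_column {n : ℕ} (r c : Fin n → R) (A : Matrix (Fin n) (Fin n) R) :
    (Matrix.of fun i j => r i * c j * A i j).det = (∏ i, r i) * (∏ j, c j) * A.det := by
  have h : (Matrix.of fun i j => r i * c j * A i j) =
      Matrix.of fun i j => r i * (Matrix.of fun i j => c j * A i j) i j := by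
    ext i j
    simp [mul_assoc]
  rw [h, Matrix.det_mul_column, Matrix.det_mul_row, mul_assoc]

theorem krattenthalerMatrix_submatrix_castSucc_castSucc (n : ℕ) (x y : R) :
    (krattenthalerMatrix (n + 1) x y).submatrix Fin.castSucc Fin.castSucc =
      krattenthalerMatrix n x y := rfl

theorem det_krattenthalerMatrix_submatrix_succ_succ (n : ℕ) (x y : R) :
    ((krattenthalerMatrix (n + 1) x y).submatrix Fin.succ Fin.succ).det =
      (∏ i ∈ range n, (x + y + (i + 1)) * (x + 2 * (i + 1))) * (∏ j ∈ range n, (y + 2 * (j + 1))) *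
        (krattenthalerMatrix n (x + 1) (y + 1)).det := by
  simp only [← Fin.prod_univ_eq_prod_range (fun i : ℕ => (x + y + (i + 1)) * (x + 2 * (i + 1))),
    ← Fin.prod_univ_eq_prod_range (fun j : ℕ => y + 2 * ((j : R) + 1))]
  rw [← Matrix.det_mul_row_mul_column]
  congr 1
  ext i j
  simp only [krattenthalerMatrix, Matrix.submatrix_apply, Matrix.of_apply, Fin.val_succ,
    ascPochhammer_eval_succ_left, descPochhammer_eval_succ_left, Nat.cast_add, Nat.cast_one]
  rw [show x + y + ((i : ℕ) + 1 : R) + 1 = x + 1 + (y + 1) + (i : ℕ) by ring,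
    show x + 2 * ((i : ℕ) + 1 : R) - 1 = x + 1 + 2 * (i : ℕ) by ring,
    show y + 2 * ((j : ℕ) + 1 : R) - 1 = y + 1 + 2 * (j : ℕ) by ring]
  ring

theorem det_krattenthalerMatrix_submatrix_succ_castSucc (n : ℕ) (x y : R) :
    ((krattenthalerMatrix (n + 1) x y).submatrix Fin.succ Fin.castSucc).det =
      (∏ j ∈ range n, (y + 2 * j)) * (krattenthalerMatrix n (x + 2) (y - 1)).det := by
  rw [← Fin.prod_univ_eq_prod_range (fun j : ℕ => y + 2 * (j : R)), ← Matrix.det_mul_row]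
  congr 1
  ext i j
  simp only [krattenthalerMatrix, Matrix.submatrix_apply, Matrix.of_apply, Fin.val_succ,
    Fin.val_castSucc, descPochhammer_eval_succ_left, Nat.cast_add, Nat.cast_one]
  rw [show x + y + ((i : ℕ) + 1 : R) = x + 2 + (y - 1) + (i : ℕ) by ring,
    show x + 2 * ((i : ℕ) + 1 : R) = x + 2 + 2 * (i : ℕ) by ring,
    show y + 2 * ((j : ℕ) : R) - 1 = y - 1 + 2 * (j : ℕ) by ring]
  ring

theorem det_krattenthalerMatrix_submatrix_castSucc_succ (n : ℕ) (x y : R) :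
    ((krattenthalerMatrix (n + 1) x y).submatrix Fin.castSucc Fin.succ).det =
      (∏ i ∈ range n, (x + y + i) * (x + 2 * i)) *
        (krattenthalerMatrix n (x - 1) (y + 2)).det := by
  rw [← Fin.prod_univ_eq_prod_range (fun i : ℕ => (x + y + i) * (x + 2 * (i : R))),
    ← Matrix.det_mul_column]
  congr 1
  ext i j
  simp only [krattenthalerMatrix, Matrix.submatrix_apply, Matrix.of_apply, Fin.val_succ,
    Fin.val_castSucc, ascPochhammer_eval_succ_left, descPochhammer_eval_succ_left, Nat.cast_add,
    Nat.cast_one]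
  rw [show x + y + ((i : ℕ) : R) + 1 = x - 1 + (y + 2) + (i : ℕ) by ring,
    show x + 2 * ((i : ℕ) : R) - 1 = x - 1 + 2 * (i : ℕ) by ring,
    show y + 2 * ((j : ℕ) + 1 : R) = y + 2 + 2 * (j : ℕ) by ring]
  ring

theorem krattenthalerMatrix_condensation (n : ℕ) (x y : R) :
    (krattenthalerMatrix (n + 2) x y).det *
        ((∏ i ∈ range n, (x + y + (i + 1)) * (x + 2 * (i + 1))) *
          (∏ j ∈ range n, (y + 2 * (j + 1))) * (krattenthalerMatrix n (x + 1) (y + 1)).det) =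
      (krattenthalerMatrix (n + 1) x y).det *
        ((∏ i ∈ range (n + 1), (x + y + (i + 1)) * (x + 2 * (i + 1))) *
          (∏ j ∈ range (n + 1), (y + 2 * (j + 1))) *
            (krattenthalerMatrix (n + 1) (x + 1) (y + 1)).det) -
      (∏ j ∈ range (n + 1), (y + 2 * j)) * (krattenthalerMatrix (n + 1) (x + 2) (y - 1)).det *
        ((∏ i ∈ range (n + 1), (x + y + i) * (x + 2 * i)) *
          (krattenthalerMatrix (n + 1) (x - 1) (y + 2)).det) := by
  rw [← det_krattenthalerMatrix_submatrix_succ_succ, ← det_krattenthalerMatrix_submatrix_succ_succ,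
    ← det_krattenthalerMatrix_submatrix_succ_castSucc,
    ← det_krattenthalerMatrix_submatrix_castSucc_succ]
  exact Matrix.desnanot_jacobi (krattenthalerMatrix (n + 2) x y)

theorem krattenthalerFactor_mul_shift (i : ℕ) (x y : R) :
    krattenthalerFactor i (x + 2) (y - 1) * krattenthalerFactor i (x - 1) (y + 2) =
      krattenthalerFactor i x y * krattenthalerFactor i (x + 1) (y + 1) := by
  simp only [krattenthalerFactor]
  rw [show 2 * (x + 2) + (y - 1) + 2 * (i : R) = 2 * (x + 1) + (y + 1) + 2 * i by ring,
    show x + 2 + 2 * (y - 1) + 2 * (i : R) = x + 2 * y + 2 * i by ring,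
    show 2 * (x - 1) + (y + 2) + 2 * (i : R) = 2 * x + y + 2 * i by ring,
    show x - 1 + 2 * (y + 2) + 2 * (i : R) = x + 1 + 2 * (y + 1) + 2 * i by ring]
  ring

theorem krattenthalerFactor_succ (n : ℕ) (x y : R) :
    krattenthalerFactor (n + 1) x y =
      ((x + y + (n + 1)) * (x + 2 * (n + 1)) * (y + 2 * (n + 1)) - (x + y) * x * y) *
        krattenthalerFactor n (x + 1) (y + 1) := by
  simp only [krattenthalerFactor, ascPochhammer_eval_succ_left, Nat.factorial_succ, Nat.cast_mul,
    Nat.cast_add, Nat.cast_one]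
  rw [show 2 * x + y + 2 * (n + 1 : R) + 1 = 2 * (x + 1) + (y + 1) + 2 * n by ring,
    show x + 2 * y + 2 * (n + 1 : R) + 1 = x + 1 + 2 * (y + 1) + 2 * n by ring]
  ring

theorem ascPochhammer_eval_eq_prod (k : ℕ) (a : R) :
    (ascPochhammer R k).eval a = ∏ m ∈ range k, (a + m) := by
  induction k with
  | zero => simp
  | succ k ih => rw [ascPochhammer_succ_eval, ih, prod_range_succ]

theorem det_krattenthalerMatrix_of_generic [IsDomain R] [CharZero R] (n : ℕ) (x y : R)
    (h : ∀ (a b : ℕ) (c : ℤ), a + b ≠ 0 → a * x + b * y + c ≠ 0) :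
    (krattenthalerMatrix n x y).det = ∏ i ∈ range n, krattenthalerFactor i x y := by
  induction n using Nat.twoStepInduction generalizing x y with
  | zero => simp
  | one => simp [krattenthalerMatrix, krattenthalerFactor]
  | more n ih₀ ih₁ =>
    have shift (s t : ℤ) (a b : ℕ) (c : ℤ) (hab : a + b ≠ 0) :
        a * (x + s) + b * (y + t) + c ≠ 0 := by
      convert h a b (a * s + b * t + c) hab using 1
      push_cast
      ring
    have h₁ := shift 1 1
    have h₂ := shift 2 (-1)
    have h₃ := shift (-1) 2
    simp only [Int.cast_one, Int.cast_ofNat, Int.cast_neg, ← sub_eq_add_neg] at h₁ h₂ h₃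
    have cond := krattenthalerMatrix_condensation n x y
    rw [ih₀ _ _ h₁, ih₁ _ _ h, ih₁ _ _ h₁, ih₁ _ _ h₂, ih₁ _ _ h₃] at cond
    have hfac (i : ℕ) : krattenthalerFactor i (x + 1) (y + 1) ≠ 0 := by
      simp only [krattenthalerFactor, ascPochhammer_eval_eq_prod]
      refine mul_ne_zero (mul_ne_zero (by exact_mod_cast i.factorial_ne_zero)
        (prod_ne_zero_iff.2 fun m _ => ?_)) (prod_ne_zero_iff.2 fun m _ => ?_)
      · simpa [add_assoc] using h₁ 2 1 (2 * i + m) (by norm_num)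
      · simpa [add_assoc] using h₁ 1 2 (2 * i + m) (by norm_num)
    have hprod : (∏ i ∈ range n, (x + y + (i + 1)) * (x + 2 * (i + 1))) *
        (∏ j ∈ range n, (y + 2 * (j + 1))) *
          ∏ i ∈ range n, krattenthalerFactor i (x + 1) (y + 1) ≠ 0 := by
      refine mul_ne_zero (mul_ne_zero (prod_ne_zero_iff.2 fun i _ => mul_ne_zero ?_ ?_)
        (prod_ne_zero_iff.2 fun i _ => ?_)) (prod_ne_zero_iff.2 fun i _ => hfac i)
      · simpa using h 1 1 (i + 1) (by norm_num)
      · simpa using h 1 0 (2 * (i + 1)) (by norm_num)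
      · simpa using h 0 1 (2 * (i + 1)) (by norm_num)
    have hshift : (∏ i ∈ range (n + 1), krattenthalerFactor i (x + 2) (y - 1)) *
        ∏ i ∈ range (n + 1), krattenthalerFactor i (x - 1) (y + 2) =
        (∏ i ∈ range (n + 1), krattenthalerFactor i x y) *
          ∏ i ∈ range (n + 1), krattenthalerFactor i (x + 1) (y + 1) := by
      simp only [← prod_mul_distrib, krattenthalerFactor_mul_shift]
    refine mul_right_cancel₀ hprod (cond.trans ?_)
    have e₁ := prod_range_succ' (fun j : ℕ => y + 2 * (j : R)) n
    have e₂ := prod_range_succ' (fun i : ℕ => (x + y + i) * (x + 2 * (i : R))) n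
    simp only [Nat.cast_add, Nat.cast_one, Nat.cast_zero, mul_zero, add_zero] at e₁ e₂
    rw [mul_mul_mul_comm (∏ j ∈ range (n + 1), (y + 2 * (j : R))), hshift, e₁, e₂,
      prod_range_succ _ (n + 1), krattenthalerFactor_succ]
    simp only [prod_range_succ _ n]
    ring

/-- Krattenthaler's determinant
`det ((x + y + i + j - 1)! / ((x + 2 * i - j)! * (y + 2 * j - i)!))`. -/
theorem det_krattenthalerMatrix (n : ℕ) (x y : ℚ) :
    (krattenthalerMatrix n x y).det = ∏ i ∈ range n, krattenthalerFactor i x y := by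
  have h := det_krattenthalerMatrix_of_generic (R := Polynomial ℚ) n
    (Polynomial.X + Polynomial.C x) (Polynomial.X + Polynomial.C y) (by
      intro a b c hab h0
      have h1 : Polynomial.C (a + b : ℚ) * Polynomial.X +
          Polynomial.C (a * x + b * y + c) = 0 := by
        rw [← h0]
        simp only [map_add, map_mul, map_natCast, map_intCast]
        ring
      have h2 := congrArg (fun p => Polynomial.coeff p 1) h1
      simp only [Polynomial.coeff_add, Polynomial.coeff_C_mul, Polynomial.coeff_X_one,
        Polynomial.coeff_C_succ, Polynomial.coeff_zero, mul_one, add_zero] at h2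
      exact hab (by exact_mod_cast h2))
  have hasc (k : ℕ) (p : Polynomial ℚ) :
      ((ascPochhammer (Polynomial ℚ) k).eval p).eval 0 = (ascPochhammer ℚ k).eval (p.eval 0) := by
    simp [ascPochhammer_eval_eq_prod, Polynomial.eval_prod]
  have hdesc (k : ℕ) (p : Polynomial ℚ) :
      ((descPochhammer (Polynomial ℚ) k).eval p).eval 0 =
        (descPochhammer ℚ k).eval (p.eval 0) := by
    induction k generalizing p with
    | zero => simp
    | succ k ih => simp [descPochhammer_eval_succ_left, ih]
  have h2 := congrArg (Polynomial.evalRingHom (0 : ℚ)) h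
  rw [RingHom.map_det, map_prod] at h2
  convert h2 using 2
  · ext i j
    simp [krattenthalerMatrix, hasc, hdesc]
  · simp [krattenthalerFactor, hasc]

end Krattenthaler

theorem asc_eq_ascPochhammer_eval (a k : ℕ) : asc a k = (ascPochhammer ℚ k).eval (a : ℚ) :=
  (ascPochhammer_eval_eq_prod k (a : ℚ)).symm

theorem half_choose_add_choose {m k l : ℕ} (h : k + l = m + 1) :
    (1 / 2 : ℚ) * C m k + C m (k - 1) =
      ((l : ℚ) + 2 * k) / 2 * m.factorial / (k.factorial * l.factorial) := by
  have hC (a : ℕ) : C m a = (m.choose a : ℚ) := by simp [C]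
  rw [hC]
  rcases k with _ | k
  · obtain rfl : l = m + 1 := by omega
    have : (m.factorial : ℚ) ≠ 0 := by exact_mod_cast m.factorial_ne_zero
    simp [C, Nat.factorial_succ]
    field_simp
  · rw [show ((k + 1 : ℕ) : ℤ) - 1 = (k : ℕ) by push_cast; ring, hC]
    have hk : (k.factorial : ℚ) ≠ 0 := by exact_mod_cast k.factorial_ne_zero
    rcases l with _ | l
    · obtain rfl : m = k := by omega
      simp [Nat.factorial_succ]
      field_simp
    · obtain rfl : m = k + l + 1 := by omega
      have hl : (l.factorial : ℚ) ≠ 0 := by exact_mod_cast l.factorial_ne_zero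
      rw [Nat.cast_choose ℚ (show k + 1 ≤ k + l + 1 by omega),
        Nat.cast_choose ℚ (show k ≤ k + l + 1 by omega),
        show k + l + 1 - (k + 1) = l by omega, show k + l + 1 - k = l + 1 by omega]
      simp only [Nat.factorial_succ, Nat.cast_mul, Nat.cast_add, Nat.cast_one]
      field_simp

theorem entry_eq_krattenthalerMatrix {x : ℕ} (hx : 0 < x) {n : ℕ} (i j : Fin n) :
    (1 / 2 : ℚ) * C (x + (i : ℕ) + (j : ℕ) - 1) (2 * (i : ℤ) - (j : ℤ)) +
        C (x + (i : ℕ) + (j : ℕ) - 1) (2 * (i : ℤ) - (j : ℤ) - 1) =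
      (((x : ℚ) + 3 * (i : ℕ)) / 2 * (x + i - 1).factorial / (2 * (i : ℕ)).factorial) *
        (1 / (x + 2 * (j : ℕ)).factorial) * krattenthalerMatrix n (0 : ℚ) x i j := by
  obtain ⟨i, hi⟩ := i
  obtain ⟨j, hj⟩ := j
  have e : krattenthalerMatrix n (0 : ℚ) x ⟨i, hi⟩ ⟨j, hj⟩ =
      (x + i).ascFactorial j * (2 * i).descFactorial j * (x + 2 * j).descFactorial i := by
    rw [← ascPochhammer_nat_eq_natCast_ascFactorial, ← descPochhammer_eval_eq_descFactorial,
      ← descPochhammer_eval_eq_descFactorial]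
    simp [krattenthalerMatrix]
  rw [e]
  dsimp only
  rcases lt_or_ge (2 * i) j with h | h
  · rw [Nat.descFactorial_of_lt h, C, C, if_neg (by omega), if_neg (by omega)]
    simp
  obtain ⟨k, hk⟩ := Nat.exists_eq_add_of_le h
  rw [show 2 * (i : ℤ) - j = (k : ℕ) by omega]
  rcases lt_or_ge (x + 2 * j) i with h' | h'
  · rw [Nat.descFactorial_of_lt h', C, C, if_pos (by omega), if_pos (by omega),
      Nat.choose_eq_zero_of_lt (by omega), Nat.choose_eq_zero_of_lt (by omega)]
    simp
  obtain ⟨l, hl⟩ := Nat.exists_eq_add_of_le h'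
  rw [half_choose_add_choose (l := l) (by omega)]
  have h₁ := Nat.factorial_mul_ascFactorial' (x + i) j (by omega)
  have h₂ := Nat.factorial_mul_descFactorial h
  have h₃ := Nat.factorial_mul_descFactorial h'
  rw [show 2 * i - j = k by omega] at h₂
  rw [show x + 2 * j - i = l by omega] at h₃
  have h₄ : (l : ℚ) + 2 * k = x + 3 * i := by
    have : l + 2 * k = x + 3 * i := by omega
    exact_mod_cast this
  rw [← h₁, ← h₂, ← h₃, h₄]
  have f (a : ℕ) : (a.factorial : ℚ) ≠ 0 := by exact_mod_cast a.factorial_ne_zero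
  have d₁ : ((2 * i).descFactorial j : ℚ) ≠ 0 := by
    exact_mod_cast fun hz => h.not_gt (Nat.descFactorial_eq_zero_iff_lt.1 hz)
  have d₂ : ((x + 2 * j).descFactorial i : ℚ) ≠ 0 := by
    exact_mod_cast fun hz => h'.not_gt (Nat.descFactorial_eq_zero_iff_lt.1 hz)
  have fk := f k
  have fl := f l
  push_cast
  field_simp

theorem det_A_region (x n : ℕ) (hx : 0 < x) :
    Matrix.det (fun i j : Fin n =>
        (1 / 2 : ℚ) * C (x + (i : ℕ) + (j : ℕ) - 1) (2 * (i : ℤ) - (j : ℤ)) +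
          C (x + (i : ℕ) + (j : ℕ) - 1) (2 * (i : ℤ) - (j : ℤ) - 1)) =
      ((2 : ℚ) ^ n)⁻¹ * (∏ i ∈ Finset.range n, ((x : ℚ) + 3 * i)) *
        ∏ i ∈ Finset.range n,
          ((i.factorial : ℚ) * ((x + i - 1).factorial : ℚ) *
              asc (2 * x + 2 * i) i * asc (x + 2 * i) i) /
            (((x + 2 * i).factorial : ℚ) * ((2 * i).factorial : ℚ)) := by
  simp only [entry_eq_krattenthalerMatrix hx]
  refine (Matrix.det_mul_row_mul_column _ _ _).trans ?_
  rw [Fin.prod_univ_eq_prod_range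
      (fun i : ℕ => ((x : ℚ) + 3 * i) / 2 * (x + i - 1).factorial / (2 * i).factorial),
    Fin.prod_univ_eq_prod_range (fun j : ℕ => 1 / ((x + 2 * j).factorial : ℚ)),
    det_krattenthalerMatrix]
  have h2 : ((2 : ℚ) ^ n)⁻¹ = ∏ _i ∈ range n, (2 : ℚ)⁻¹ := by simp
  rw [h2]
  simp only [← prod_mul_distrib]
  refine prod_congr rfl fun i _ => ?_
  simp only [krattenthalerFactor, asc_eq_ascPochhammer_eval, Nat.cast_add, Nat.cast_mul,
    Nat.cast_ofNat, mul_zero, zero_add]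
  field_simp
end

section
/- Let x be a positive integer and n a nonnegative integer. Then det( C(x+i+j-1, 2i-j) + (1/2)·C(x+i+j-1, 2i-j-1) )_{0≤i,j≤n-1} = 2^{-n} · ∏_{i=0}^{n-1} (2x+3i) · ∏_{i=0}^{n-1} [ i! · (x+i-1)! · (2x+2i)_i · (x+2i)_i ] / [ (x+2i)! · (2i)! ]. -/
open Finset

namespace Matrix

variable {K : Type*} [Field K]

/-- A determinant bordered by one row and one column, as a Schur complement. -/
theorem det_submatrix_cons {m : Type*} {n : ℕ} (M : Matrix m m K) (e : Fin n → m)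
    (h : (M.submatrix e e).det ≠ 0) (p q : m) :
    (M.submatrix (Fin.cons p e) (Fin.cons q e)).det = (M.submatrix e e).det *
      (M p q - ((fun j => M p (e j)) ᵥ* (M.submatrix e e)⁻¹) ⬝ᵥ fun i => M (e i) q) := by
  have hbij : Function.Bijective
      (Sum.elim Fin.succ (fun _ => 0) : Fin n ⊕ Fin 1 → Fin (n + 1)) := by
    rw [Fintype.bijective_iff_injective_and_card]
    refine ⟨?_, by simp⟩
    rintro (a | a) (b | b) hab <;> simp_all [Fin.succ_ne_zero, (Fin.succ_ne_zero _).symm]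
    exact Subsingleton.elim _ _
  have : Invertible (M.submatrix e e) := invertibleOfIsUnitDet _ (isUnit_iff_ne_zero.mpr h)
  have hblock : (M.submatrix (Fin.cons p e) (Fin.cons q e)).submatrix
      (Equiv.ofBijective _ hbij) (Equiv.ofBijective _ hbij) =
      fromBlocks (M.submatrix e e) (of fun i _ => M (e i) q) (of fun _ j => M p (e j))
        (of fun _ _ => M p q) := by
    ext (i | i) (j | j) <;> simp
  rw [← det_submatrix_equiv_self (Equiv.ofBijective _ hbij), hblock, det_fromBlocks₁₁,
    det_fin_one, invOf_eq_nonsing_inv]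
  rfl

theorem det_submatrix_cons_snoc {m : Type*} {n : ℕ} (M : Matrix m m K) (e : Fin n → m) (p q : m) :
    (M.submatrix (Fin.cons p e) (Fin.snoc (α := fun _ => m) e q)).det =
      (-1) ^ n * (M.submatrix (Fin.cons p e) (Fin.cons q e)).det := by
  have := det_permute' (finRotate (n + 1)) (M.submatrix (Fin.cons p e) (Fin.cons q e))
  rw [sign_finRotate] at this
  simp only [Nat.add_sub_cancel, Units.val_pow_eq_pow_val, Units.val_neg, Units.val_one,
    Int.cast_pow, Int.cast_neg, Int.cast_one] at this
  rw [← this, submatrix_submatrix, Fin.snoc_eq_cons_rotate]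
  rfl

theorem det_submatrix_snoc_cons {m : Type*} {n : ℕ} (M : Matrix m m K) (e : Fin n → m) (p q : m) :
    (M.submatrix (Fin.snoc (α := fun _ => m) e p) (Fin.cons q e)).det =
      (-1) ^ n * (M.submatrix (Fin.cons p e) (Fin.cons q e)).det := by
  rw [← det_transpose, transpose_submatrix, det_submatrix_cons_snoc, ← transpose_submatrix,
    det_transpose]

theorem det_submatrix_snoc {m : Type*} {n : ℕ} (M : Matrix m m K) (e : Fin n → m) (p q : m) :
    (M.submatrix (Fin.snoc (α := fun _ => m) e p) (Fin.snoc (α := fun _ => m) e q)).det =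
      (M.submatrix (Fin.cons p e) (Fin.cons q e)).det := by
  rw [Fin.snoc_eq_cons_rotate, Fin.snoc_eq_cons_rotate]
  exact det_submatrix_equiv_self (finRotate (n + 1)) (M.submatrix (Fin.cons p e) (Fin.cons q e))

/-- The Desnanot–Jacobi identity (Dodgson condensation), for an invertible central minor. -/
theorem det_mul_det_central {n : ℕ} (M : Matrix (Fin (n + 2)) (Fin (n + 2)) K)
    (h : (M.submatrix (fun i : Fin n => i.succ.castSucc) fun i => i.succ.castSucc).det ≠ 0) :
    M.det * (M.submatrix (fun i : Fin n => i.succ.castSucc) fun i => i.succ.castSucc).det =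
      (M.submatrix Fin.castSucc Fin.castSucc).det * (M.submatrix Fin.succ Fin.succ).det -
      (M.submatrix Fin.succ Fin.castSucc).det * (M.submatrix Fin.castSucc Fin.succ).det := by
  set e : Fin n → Fin (n + 2) := fun i => i.succ.castSucc with he
  have hcast : (Fin.castSucc : Fin (n + 1) → Fin (n + 2)) = Fin.cons 0 e := by
    funext i
    refine Fin.cases ?_ (fun j => ?_) i <;> simp [he]
  have hsucc : (Fin.succ : Fin (n + 1) → Fin (n + 2)) =
      Fin.snoc (α := fun _ => Fin (n + 2)) e (Fin.last _) := by
    funext i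
    refine Fin.lastCases ?_ (fun j => ?_) i <;> simp [he]
  have hbij : Function.Bijective
      (Sum.elim e ![0, Fin.last (n + 1)] : Fin n ⊕ Fin 2 → Fin (n + 2)) := by
    rw [Fintype.bijective_iff_injective_and_card]
    refine ⟨?_, by simp⟩
    rintro (a | a) (b | b) hab
    · simpa [he] using hab
    · fin_cases b <;> simp [he, Fin.ext_iff] at hab
      omega
    · fin_cases a <;> simp [he, Fin.ext_iff] at hab
      omega
    · fin_cases a <;> fin_cases b <;> simp [Fin.ext_iff] at hab ⊢
  have : Invertible (M.submatrix e e) := invertibleOfIsUnitDet _ (isUnit_iff_ne_zero.mpr h)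
  have hblock : M.submatrix (Equiv.ofBijective _ hbij) (Equiv.ofBijective _ hbij) =
      fromBlocks (M.submatrix e e) (of fun i k => M (e i) (![0, Fin.last (n + 1)] k))
        (of fun k j => M (![0, Fin.last (n + 1)] k) (e j))
        (of fun k l => M (![0, Fin.last (n + 1)] k) (![0, Fin.last (n + 1)] l)) := by
    ext (i | i) (j | j) <;> simp
  let S : Fin (n + 2) → Fin (n + 2) → K := fun p q =>
    M p q - ((fun j => M p (e j)) ᵥ* (M.submatrix e e)⁻¹) ⬝ᵥ fun i => M (e i) q
  have hminor (p q : Fin (n + 2)) :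
      (M.submatrix (Fin.cons p e) (Fin.cons q e)).det = (M.submatrix e e).det * S p q :=
    det_submatrix_cons M e h p q
  have hdet : M.det = (M.submatrix e e).det *
      (S 0 0 * S (Fin.last _) (Fin.last _) - S 0 (Fin.last _) * S (Fin.last _) 0) := by
    rw [← det_submatrix_equiv_self (Equiv.ofBijective _ hbij), hblock, det_fromBlocks₁₁,
      det_fin_two, invOf_eq_nonsing_inv]
    rfl
  have hsign : ((-1 : K) ^ n) * (-1) ^ n = 1 := by
    rw [← mul_pow]; simp
  rw [hdet, hcast, hsucc, det_submatrix_snoc, det_submatrix_cons_snoc, det_submatrix_snoc_cons]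
  simp only [hminor]
  linear_combination
    (M.submatrix e e).det ^ 2 * S 0 (Fin.last _) * S (Fin.last _) 0 * hsign

end Matrix

/-- The reciprocal factorial `1 / k!`, extended by zero to negative integers. -/
def invFactorial (k : ℤ) : ℚ := if 0 ≤ k then ((k.toNat.factorial : ℚ))⁻¹ else 0

theorem invFactorial_natCast (k : ℕ) : invFactorial k = (k.factorial : ℚ)⁻¹ := by
  simp [invFactorial]

theorem invFactorial_of_neg {k : ℤ} (hk : k < 0) : invFactorial k = 0 := by
  simp [invFactorial, hk]

/-- The matrix with entries `(x+y+i+j-1)! / ((x+2i-j)! (y+2j-i)!)`. -/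
def factorialMatrix (x y : ℤ) (n : ℕ) : Matrix (Fin n) (Fin n) ℚ :=
  .of fun i j => ((x + y + i + j - 1).toNat.factorial : ℚ) *
    invFactorial (x + 2 * i - j) * invFactorial (y + 2 * j - i)

/-- The `i`-th factor of the product evaluating `det (factorialMatrix x y n)`. -/
def productFactor (x y i : ℕ) : ℚ :=
  i.factorial * (x + y + i - 1).factorial * asc (2 * x + y + 2 * i) i * asc (x + 2 * y + 2 * i) i /
    ((x + 2 * i).factorial * (y + 2 * i).factorial)

theorem asc_pos {a k : ℕ} (h : 0 < a) : 0 < asc a k :=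
  prod_pos fun _ _ => by positivity

theorem asc_succ' (a k : ℕ) : asc a (k + 1) = a * asc (a + 1) k := by
  rw [asc, prod_range_succ', mul_comm, asc]
  simp [add_assoc, add_comm (1 : ℚ)]

theorem productFactor_pos {x y : ℕ} (h : 0 < x + y) (i : ℕ) : 0 < productFactor x y i := by
  have h₁ := asc_pos (k := i) (show 0 < 2 * x + y + 2 * i by omega)
  have h₂ := asc_pos (k := i) (show 0 < x + 2 * y + 2 * i by omega)
  unfold productFactor
  positivity

theorem productFactor_succ {x y : ℕ} (h : 0 < x + y) (m : ℕ) :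
    productFactor x y (m + 1) * ((x + y + (m + 1)) * (x + 2 * (m + 1)) * (y + 2 * (m + 1))) =
      productFactor (x + 1) (y + 1) m *
        ((m + 1) * (2 * x + y + 2 * (m + 1)) * (x + 2 * y + 2 * (m + 1))) := by
  have e₁ : x + y + (m + 1) - 1 = x + y + m := by omega
  have e₂ : x + 1 + (y + 1) + m - 1 = x + y + m + 1 := by omega
  have e₃ : x + 2 * (m + 1) = x + 1 + 2 * m + 1 := by omega
  have e₄ : y + 2 * (m + 1) = y + 1 + 2 * m + 1 := by omega
  have e₅ : 2 * (x + 1) + (y + 1) + 2 * m = 2 * x + y + 2 * (m + 1) + 1 := by omega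
  have e₆ : x + 1 + 2 * (y + 1) + 2 * m = x + 2 * y + 2 * (m + 1) + 1 := by omega
  unfold productFactor
  rw [e₁, e₂, e₃, e₄, e₅, e₆, asc_succ', asc_succ']
  simp only [Nat.factorial_succ]
  push_cast
  field_simp
  ring

/-- One step of the telescoping in `prod_productFactor_shift`. -/
theorem productFactor_shift_mul (u v k : ℕ) :
    productFactor (u + 3) v (k + 1) * productFactor u (v + 3) (k + 1) *
      ((u + v + 3 + (k + 1)) * (u + 2 * (k + 1) + 3) * (v + 2 * (k + 1) + 3)) =
    productFactor (u + 1) (v + 1) (k + 1) * productFactor (u + 2) (v + 2) (k + 1) *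
      ((u + v + 3 + k) * (u + 2 * k + 3) * (v + 2 * k + 3)) := by
  have e₁ : u + 3 + v + (k + 1) - 1 = u + v + k + 2 + 1 := by omega
  have e₂ : u + (v + 3) + (k + 1) - 1 = u + v + k + 2 + 1 := by omega
  have e₃ : u + 1 + (v + 1) + (k + 1) - 1 = u + v + k + 2 := by omega
  have e₄ : u + 2 + (v + 2) + (k + 1) - 1 = u + v + k + 2 + 1 + 1 := by omega
  have f (w c : ℕ) : w + c + 2 * (k + 1) = w + 2 * k + 2 + c := by omega
  have f₀ (w : ℕ) : w + 2 * (k + 1) = w + 2 * k + 2 := by omega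
  have a₁ : 2 * (u + 3) + v + 2 * (k + 1) = 2 * (u + 2) + (v + 2) + 2 * (k + 1) := by omega
  have a₂ : 2 * u + (v + 3) + 2 * (k + 1) = 2 * (u + 1) + (v + 1) + 2 * (k + 1) := by omega
  have b₁ : u + 3 + 2 * v + 2 * (k + 1) = u + 1 + 2 * (v + 1) + 2 * (k + 1) := by omega
  have b₂ : u + 2 * (v + 3) + 2 * (k + 1) = u + 2 + 2 * (v + 2) + 2 * (k + 1) := by omega
  unfold productFactor
  rw [e₁, e₂, e₃, e₄, a₁, a₂, b₁, b₂]
  simp only [f, f₀ u, f₀ v, Nat.factorial_succ (u + v + k + 2),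
    Nat.factorial_succ (u + v + k + 2 + 1), Nat.factorial_succ (u + 2 * k + 2),
    Nat.factorial_succ (u + 2 * k + 2 + 1), Nat.factorial_succ (u + 2 * k + 2 + 2),
    Nat.factorial_succ (v + 2 * k + 2),
    Nat.factorial_succ (v + 2 * k + 2 + 1), Nat.factorial_succ (v + 2 * k + 2 + 2)]
  push_cast
  field_simp
  ring

theorem prod_productFactor_shift (u v k : ℕ) :
    (∏ i ∈ range (k + 1), productFactor (u + 3) v i) *
        (∏ i ∈ range (k + 1), productFactor u (v + 3) i) *
        ((u + v + 3 + k) * (u + 2 * k + 3) * (v + 2 * k + 3)) =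
      (∏ i ∈ range (k + 1), productFactor (u + 1) (v + 1) i) *
        (∏ i ∈ range (k + 1), productFactor (u + 2) (v + 2) i) *
        ((u + 1) * (v + 1) * (u + v + 2)) := by
  induction k with
  | zero =>
    have e₁ : u + 3 + v - 1 = u + v + 2 := by omega
    have e₂ : u + (v + 3) - 1 = u + v + 2 := by omega
    have e₃ : u + 1 + (v + 1) - 1 = u + v + 1 := by omega
    have e₄ : u + 2 + (v + 2) - 1 = u + v + 3 := by omega
    simp only [zero_add, range_one, prod_singleton, productFactor, asc, range_zero, prod_empty,
      mul_zero, add_zero, e₁, e₂, e₃, e₄, Nat.factorial_succ]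
    push_cast
    field_simp
    ring
  | succ k ih =>
    have h := productFactor_shift_mul u v k
    rw [prod_range_succ _ (k + 1), prod_range_succ _ (k + 1), prod_range_succ _ (k + 1),
      prod_range_succ _ (k + 1)]
    have hne : ((u : ℚ) + v + 3 + k) * (u + 2 * k + 3) * (v + 2 * k + 3) ≠ 0 := by positivity
    push_cast at h ih ⊢
    apply mul_right_cancel₀ hne
    linear_combination (∏ i ∈ range (k + 1), productFactor (u + 3) v i) *
        (∏ i ∈ range (k + 1), productFactor u (v + 3) i) *
        ((u + v + 3 + k) * (u + 2 * k + 3) * (v + 2 * k + 3)) * h +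
        productFactor (u + 1) (v + 1) (k + 1) * productFactor (u + 2) (v + 2) (k + 1) *
      ((u + v + 3 + k) * (u + 2 * k + 3) * (v + 2 * k + 3)) * ih

theorem factorialMatrix_submatrix_castSucc (x y : ℤ) (n : ℕ) :
    (factorialMatrix x y (n + 1)).submatrix Fin.castSucc Fin.castSucc = factorialMatrix x y n := by
  ext i j
  simp [factorialMatrix]

theorem factorialMatrix_submatrix_succ (x y : ℤ) (n : ℕ) :
    (factorialMatrix x y (n + 1)).submatrix Fin.succ Fin.succ =
      factorialMatrix (x + 1) (y + 1) n := by
  ext i j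
  simp only [factorialMatrix, Matrix.submatrix_apply, Matrix.of_apply, Fin.val_succ]
  push_cast
  ring_nf

theorem factorialMatrix_submatrix_succ_castSucc (x y : ℤ) (n : ℕ) :
    (factorialMatrix x y (n + 1)).submatrix Fin.succ Fin.castSucc =
      factorialMatrix (x + 2) (y - 1) n := by
  ext i j
  simp only [factorialMatrix, Matrix.submatrix_apply, Matrix.of_apply, Fin.val_succ,
    Fin.val_castSucc]
  push_cast
  ring_nf

theorem factorialMatrix_submatrix_castSucc_succ (x y : ℤ) (n : ℕ) :
    (factorialMatrix x y (n + 1)).submatrix Fin.castSucc Fin.succ =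
      factorialMatrix (x - 1) (y + 2) n := by
  ext i j
  simp only [factorialMatrix, Matrix.submatrix_apply, Matrix.of_apply, Fin.val_succ,
    Fin.val_castSucc]
  push_cast
  ring_nf

theorem factorialMatrix_submatrix_central (x y : ℤ) (n : ℕ) :
    ((factorialMatrix x y (n + 2)).submatrix (fun i : Fin n => i.succ.castSucc)
      fun i => i.succ.castSucc) = factorialMatrix (x + 1) (y + 1) n := by
  rw [← factorialMatrix_submatrix_succ, ← factorialMatrix_submatrix_castSucc]
  rfl

theorem det_factorialMatrix_neg_one_left (y : ℤ) (n : ℕ) :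
    (factorialMatrix (-1) y (n + 1)).det = 0 := by
  refine Matrix.det_eq_zero_of_row_eq_zero 0 fun j => ?_
  rw [factorialMatrix, Matrix.of_apply, invFactorial_of_neg (by simp; omega)]
  ring

theorem det_factorialMatrix_neg_one_right (x : ℤ) (n : ℕ) :
    (factorialMatrix x (-1) (n + 1)).det = 0 := by
  refine Matrix.det_eq_zero_of_column_eq_zero 0 fun j => ?_
  rw [factorialMatrix, Matrix.of_apply, invFactorial_of_neg (k := -1 + _ - _) (by simp; omega)]
  ring

theorem det_factorialMatrix (n : ℕ) : ∀ x y : ℕ, 0 < x + y →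
    (factorialMatrix x y n).det = ∏ i ∈ range n, productFactor x y i := by
  induction n using Nat.twoStepInduction with
  | zero => simp
  | one =>
    intro x y h
    have e : ((x : ℤ) + y - 1).toNat = x + y - 1 := by omega
    simp [factorialMatrix, productFactor, invFactorial_natCast, asc, e]
    field_simp
  | more n ih₀ ih₁ =>
    intro x y h
    have hpos (z w : ℕ) (hzw : 0 < z + w) (m : ℕ) : 0 < ∏ i ∈ range m, productFactor z w i :=
      prod_pos fun i _ => productFactor_pos hzw i
    have hcentral := ih₀ (x + 1) (y + 1) (by omega)
    have hsucc := ih₁ (x + 1) (y + 1) (by omega)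
    have hne := (hpos (x + 1) (y + 1) (by omega) n).ne'
    have hcond := Matrix.det_mul_det_central (factorialMatrix x y (n + 2)) (by
      rw [factorialMatrix_submatrix_central]
      push_cast at hcentral
      rwa [hcentral])
    push_cast at hcentral hsucc
    rw [factorialMatrix_submatrix_central, factorialMatrix_submatrix_castSucc,
      factorialMatrix_submatrix_succ, factorialMatrix_submatrix_succ_castSucc,
      factorialMatrix_submatrix_castSucc_succ, hcentral, hsucc, ih₁ x y h] at hcond
    have hfac := productFactor_succ h n
    have hoff : (factorialMatrix (x + 2) (y - 1) (n + 1)).det *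
          (factorialMatrix (x - 1) (y + 2) (n + 1)).det *
          ((x + y + (n + 1)) * (x + 2 * (n + 1)) * (y + 2 * (n + 1))) =
        (∏ i ∈ range (n + 1), productFactor x y i) *
          (∏ i ∈ range (n + 1), productFactor (x + 1) (y + 1) i) * (x * y * (x + y)) := by
      rcases x with _ | u
      · simp [det_factorialMatrix_neg_one_left]
      rcases y with _ | v
      · simp [det_factorialMatrix_neg_one_right]
      have h₁ := ih₁ (u + 3) v (by omega)
      have h₂ := ih₁ u (v + 3) (by omega)
      have h₃ := prod_productFactor_shift u v n
      rw [← h₁, ← h₂] at h₃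
      push_cast at h₃ ⊢
      rw [show (u : ℤ) + 1 + 2 = u + 3 by ring, show (v : ℤ) + 1 + 2 = v + 3 by ring,
        add_sub_cancel_right, add_sub_cancel_right]
      linear_combination h₃
    rw [prod_range_succ _ (n + 1)]
    have hden : ((x : ℚ) + y + (n + 1)) * (x + 2 * (n + 1)) * (y + 2 * (n + 1)) ≠ 0 := by
      positivity
    apply mul_right_cancel₀ hden
    apply mul_right_cancel₀ hne
    rw [prod_range_succ (productFactor (x + 1) (y + 1))] at hcond hoff
    linear_combination ((x : ℚ) + y + (n + 1)) * (x + 2 * (n + 1)) * (y + 2 * (n + 1)) * hcond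
      - hoff - (∏ i ∈ range (n + 1), productFactor x y i) *
        (∏ i ∈ range n, productFactor (x + 1) (y + 1) i) * hfac

/-- `C(m,k) + C(m,k-1)/2` as a multiple of a product of reciprocal factorials. -/
theorem C_add_half_mul_C (m : ℕ) (k l : ℤ) (h : k + l = m + 1) :
    C m k + (1 / 2 : ℚ) * C m (k - 1) =
      (l + k / 2) * (m.factorial * invFactorial k * invFactorial l) := by
  rcases lt_or_ge k 0 with hk | hk
  · simp [C, invFactorial_of_neg hk, not_le.mpr hk, show ¬ 1 ≤ k by omega]
  rcases lt_or_ge l 0 with hl | hl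
  · have h₁ : m < k.toNat := by omega
    have h₂ : m < k.toNat - 1 := by omega
    simp [C, invFactorial_of_neg hl, Nat.choose_eq_zero_of_lt h₁, Nat.choose_eq_zero_of_lt h₂]
  lift k to ℕ using hk
  lift l to ℕ using hl
  have hm : k + l = m + 1 := by exact_mod_cast h
  rw [invFactorial_natCast, invFactorial_natCast]
  have hC (r s : ℕ) (hrs : r + s = m) : C m r = m.factorial / (r.factorial * s.factorial) := by
    subst hrs
    simp [C, Nat.cast_add_choose]
  rcases k with _ | k
  · obtain rfl : l = m + 1 := by omega
    have h₀ : C m ((0 : ℕ) : ℤ) = 1 := by simp [C]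
    have h₁ : C m (((0 : ℕ) : ℤ) - 1) = 0 := by simp [C]
    rw [h₀, h₁, Nat.factorial_succ]
    push_cast
    field_simp
    simp
  rw [show ((k + 1 : ℕ) : ℤ) - 1 = (k : ℤ) by push_cast; ring, hC k l (by omega)]
  rcases l with _ | l
  · have h₀ : C m ((k + 1 : ℕ) : ℤ) = 0 := by
      simp [C, Nat.choose_eq_zero_of_lt (show m < k + 1 by omega)]
    rw [h₀, Nat.factorial_succ]
    push_cast
    field_simp
    simp
  · rw [hC (k + 1) l (by omega), Nat.factorial_succ, Nat.factorial_succ]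
    push_cast
    field_simp

theorem det_B_region (x n : ℕ) (hx : 0 < x) :
    Matrix.det (fun i j : Fin n =>
        C (x + (i : ℕ) + (j : ℕ) - 1) (2 * (i : ℤ) - (j : ℤ)) +
          (1 / 2 : ℚ) * C (x + (i : ℕ) + (j : ℕ) - 1) (2 * (i : ℤ) - (j : ℤ) - 1)) =
      ((2 : ℚ) ^ n)⁻¹ * (∏ i ∈ Finset.range n, (2 * (x : ℚ) + 3 * i)) *
        ∏ i ∈ Finset.range n,
          ((i.factorial : ℚ) * ((x + i - 1).factorial : ℚ) *
              asc (2 * x + 2 * i) i * asc (x + 2 * i) i) /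
            (((x + 2 * i).factorial : ℚ) * ((2 * i).factorial : ℚ)) := by
  have hentry : (fun i j : Fin n =>
        C (x + (i : ℕ) + (j : ℕ) - 1) (2 * (i : ℤ) - (j : ℤ)) +
          (1 / 2 : ℚ) * C (x + (i : ℕ) + (j : ℕ) - 1) (2 * (i : ℤ) - (j : ℤ) - 1)) =
      Matrix.of fun i j : Fin n => ((2 * (x : ℚ) + 3 * (j : ℕ)) / 2) *
        factorialMatrix (0 : ℕ) x n i j := by
    ext i j
    have e : ((0 : ℤ) + x + i + j - 1).toNat = x + i + j - 1 := by omega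
    rw [C_add_half_mul_C _ _ (x + 2 * j - i) (by omega), Matrix.of_apply, factorialMatrix,
      Matrix.of_apply, Nat.cast_zero, e, zero_add]
    push_cast
    ring
  rw [hentry, Matrix.det_mul_row, det_factorialMatrix n 0 x (by omega),
    Fin.prod_univ_eq_prod_range (fun j => (2 * (x : ℚ) + 3 * j) / 2), prod_div_distrib,
    prod_const, card_range, div_eq_inv_mul]
  congr 1
  refine prod_congr rfl fun i _ => ?_
  simp only [productFactor, mul_zero, zero_add]
  ring
end
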